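/- Input feedforward passivity index via the Bernstein certificate: Under the hypotheses of the Bernstein-certificate criterion for local dissipativity (f, h continuous; X = [-1/2,1/2]^n, U = [-1/2,1/2]^m; Bernstein polynomial approximations b_i of f_i and b'_j of h_j on X x U with uniform error bounds epsbar_i and epsbar'_j), suppose the certificate conditions of that criterion hold with the supply rate w(u, y) = u^T y - nu * u^T u for some real number nu, witnessed by a polynomial V, a positive definite polynomial phi_1, and nonnegative polynomial multipliers. Then the system x' = f(x,u), y = h(x,u) is locally input feedforward passive with index nu on X and U: V >= 0 on X, and along every trajectory with u(t) in U and x(t) in X for all t, the inequality integral from 0 to T of u(t)^T y(t) dt >= V(x(T)) - V(x(0)) + nu * integral from 0 to T of u(t)^T u(t) dt holds for all T >= 0. -/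

import Mathlib

open Finset

/-- Partial derivative of `g : ℝⁿ → ℝ` in the `j`-th coordinate direction. -/
noncomputable def pder {n : ℕ} (j : Fin n) (g : (Fin n → ℝ) → ℝ) : (Fin n → ℝ) → ℝ :=
  fun x => deriv (fun t : ℝ => g (Function.update x j t)) (x j)

/-- `g : ℝⁿ → ℝ` is a polynomial function. -/
def IsPolyFun {n : ℕ} (g : (Fin n → ℝ) → ℝ) : Prop :=
  ∃ q : MvPolynomial (Fin n) ℝ, ∀ x, g x = MvPolynomial.eval x q

/-- `g : ℝⁿ × ℝᵐ → ℝ` is a polynomial function. -/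
def IsPolyFun2 {n m : ℕ} (g : (Fin n → ℝ) → (Fin m → ℝ) → ℝ) : Prop :=
  ∃ q : MvPolynomial (Fin n ⊕ Fin m) ℝ, ∀ x u, g x u = MvPolynomial.eval (Sum.elim x u) q

/-- A positive definite (polynomial) function: vanishing at `0` and positive elsewhere. -/
def IsPosDef {n : ℕ} (φ : (Fin n → ℝ) → ℝ) : Prop :=
  φ 0 = 0 ∧ ∀ x : Fin n → ℝ, x ≠ 0 → 0 < φ x

/-- The multivariate Bernstein polynomial with degrees `μ` (in `x`) and `η` (in `u`) of a
two-argument function `g`, in the variables shifted so that the box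
`[-1/2, 1/2]ⁿ × [-1/2, 1/2]ᵐ` corresponds to the unit cube. -/
noncomputable def bernShift2 {n m : ℕ} (μ : Fin n → ℕ) (η : Fin m → ℕ)
    (g : (Fin n → ℝ) → (Fin m → ℝ) → ℝ) (x : Fin n → ℝ) (u : Fin m → ℝ) : ℝ :=
  ∑ kk ∈ Fintype.piFinset (fun j => Finset.range (μ j + 1)),
    ∑ ll ∈ Fintype.piFinset (fun j => Finset.range (η j + 1)),
      g (fun j => (kk j : ℝ) / (μ j : ℝ) - 1 / 2)
          (fun j => (ll j : ℝ) / (η j : ℝ) - 1 / 2) *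
        (∏ j, (((μ j).choose (kk j) : ℝ) * (x j + 1 / 2) ^ (kk j) *
          (1 / 2 - x j) ^ (μ j - kk j))) *
        ∏ j, (((η j).choose (ll j) : ℝ) * (u j + 1 / 2) ^ (ll j) *
          (1 / 2 - u j) ^ (η j - ll j))

/-- The input-feedforward-passivity supply rate `w(u, y) = uᵀy - ν uᵀu`. -/
def supplyIFP {m : ℕ} (ν : ℝ) (u y : Fin m → ℝ) : ℝ :=
  (∑ j, u j * y j) - ν * ∑ j, u j * u j

/-- Polynomial functions are differentiable. -/
lemma IsPolyFun.differentiable {n : ℕ} {g : (Fin n → ℝ) → ℝ} (hg : IsPolyFun g) :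
    Differentiable ℝ g := by
  obtain ⟨q, hq⟩ := hg
  obtain rfl : g = fun x => MvPolynomial.eval x q := funext hq
  exact fun x => (AnalyticOnNhd.eval_mvPolynomial q x (Set.mem_univ x)).differentiableAt

/-- The coordinate partial derivatives are the values of the Fréchet derivative at the standard
basis vectors. -/
lemma pder_eq_fderiv {n : ℕ} {g : (Fin n → ℝ) → ℝ} {x : Fin n → ℝ}
    (hg : DifferentiableAt ℝ g x) (i : Fin n) :
    pder i g x = fderiv ℝ g x (Pi.single i 1) := by
  have hu : HasDerivAt (Function.update x i) (Pi.single i (1 : ℝ)) (x i) :=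
    hasDerivAt_update x i (x i)
  have hg' : HasFDerivAt g (fderiv ℝ g x) (Function.update x i (x i)) := by
    simpa using hg.hasFDerivAt
  exact (hg'.comp_hasDerivAt (x i) hu).deriv

/-- Chain rule along a curve in terms of the coordinate partial derivatives. -/
lemma hasDerivAt_comp_pder {n : ℕ} {g : (Fin n → ℝ) → ℝ} {c : ℝ → Fin n → ℝ} {c' : Fin n → ℝ}
    {t : ℝ} (hg : DifferentiableAt ℝ g (c t)) (hc : HasDerivAt c c' t) :
    HasDerivAt (fun s => g (c s)) (∑ i, pder i g (c t) * c' i) t := by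
  refine (hg.hasFDerivAt.comp_hasDerivAt t hc).congr_deriv ?_
  have := (fderiv ℝ g (c t)).toLinearMap.pi_apply_eq_sum_univ c'
  simp only [ContinuousLinearMap.coe_coe] at this
  rw [this]
  refine Finset.sum_congr rfl fun i _ => ?_
  rw [pder_eq_fderiv hg, smul_eq_mul, mul_comm]
  congr 2
  ext j
  simp [Pi.single_apply, eq_comm]

/-- The two multiplier terms of a box constraint are nonpositive on the box. -/
lemma multiplier_nonpos {p q e r : ℝ} (hp : 0 ≤ p) (hq : 0 ≤ q) (he : |e| ≤ r) :
    p * (e - r) - q * (e + r) ≤ 0 := by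
  obtain ⟨h₁, h₂⟩ := abs_le.mp he
  have := mul_nonneg hp (sub_nonneg.mpr h₂)
  have := mul_nonneg hq (neg_le_iff_add_nonneg.mp h₁)
  linarith

/-- **Input feedforward passivity index via the Bernstein certificate** on
`X = [-1/2,1/2]ⁿ`, `U = [-1/2,1/2]ᵐ`. -/
theorem ifp_index_via_bernstein_certificate
    {n m : ℕ} (ν : ℝ)
    (f : (Fin n → ℝ) → (Fin m → ℝ) → (Fin n → ℝ))
    (h : (Fin n → ℝ) → (Fin m → ℝ) → (Fin m → ℝ))
    (hf : Continuous (Function.uncurry f)) (hh : Continuous (Function.uncurry h))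
    -- Bernstein approximations of the components of `f`, with prescribed degrees
    (μx : Fin n → Fin n → ℕ) (μu : Fin n → Fin m → ℕ)
    (hμx : ∀ i j, 0 < μx i j) (hμu : ∀ i j, 0 < μu i j)
    (ebar : Fin n → ℝ) (hebar : ∀ i, 0 ≤ ebar i)
    (hfb : ∀ i, ∀ x : Fin n → ℝ, (∀ j, |x j| ≤ 1 / 2) →
      ∀ u : Fin m → ℝ, (∀ j, |u j| ≤ 1 / 2) →
      |f x u i - bernShift2 (μx i) (μu i) (fun a b => f a b i) x u| ≤ ebar i)
    -- Bernstein approximations of the components of `h`, with prescribed degrees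
    (ηx : Fin m → Fin n → ℕ) (ηu : Fin m → Fin m → ℕ)
    (hηx : ∀ i j, 0 < ηx i j) (hηu : ∀ i j, 0 < ηu i j)
    (ebar' : Fin m → ℝ) (hebar' : ∀ j, 0 ≤ ebar' j)
    (hhb : ∀ j, ∀ x : Fin n → ℝ, (∀ j', |x j'| ≤ 1 / 2) →
      ∀ u : Fin m → ℝ, (∀ j', |u j'| ≤ 1 / 2) →
      |h x u j - bernShift2 (ηx j) (ηu j) (fun a b => h a b j) x u| ≤ ebar' j)
    -- the storage function candidate and the multipliers
    (V : (Fin n → ℝ) → ℝ) (hV : IsPolyFun V)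
    (φ₁ : (Fin n → ℝ) → ℝ) (hφ₁ : IsPolyFun φ₁ ∧ IsPosDef φ₁)
    (s₁ s₂ : Fin n → (Fin n → ℝ) → ℝ)
    (hs₁ : ∀ i, IsPolyFun (s₁ i) ∧ ∀ x, 0 ≤ s₁ i x)
    (hs₂ : ∀ i, IsPolyFun (s₂ i) ∧ ∀ x, 0 ≤ s₂ i x)
    (s₃ s₄ s₅ s₆ : Fin n → (Fin n → ℝ) → (Fin m → ℝ) → ℝ)
    (hs₃ : ∀ i, IsPolyFun2 (s₃ i) ∧ ∀ x u, 0 ≤ s₃ i x u)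
    (hs₄ : ∀ i, IsPolyFun2 (s₄ i) ∧ ∀ x u, 0 ≤ s₄ i x u)
    (hs₅ : ∀ i, IsPolyFun2 (s₅ i) ∧ ∀ x u, 0 ≤ s₅ i x u)
    (hs₆ : ∀ i, IsPolyFun2 (s₆ i) ∧ ∀ x u, 0 ≤ s₆ i x u)
    (s₇ s₈ : Fin m → (Fin n → ℝ) → (Fin m → ℝ) → ℝ)
    (hs₇ : ∀ j, IsPolyFun2 (s₇ j) ∧ ∀ x u, 0 ≤ s₇ j x u)
    (hs₈ : ∀ j, IsPolyFun2 (s₈ j) ∧ ∀ x u, 0 ≤ s₈ j x u)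
    (s₉ s₁₀ : Fin m → (Fin n → ℝ) → (Fin m → ℝ) → ℝ)
    (hs₉ : ∀ j, IsPolyFun2 (s₉ j) ∧ ∀ x u, 0 ≤ s₉ j x u)
    (hs₁₀ : ∀ j, IsPolyFun2 (s₁₀ j) ∧ ∀ x u, 0 ≤ s₁₀ j x u)
    -- certificate condition (a)
    (ha : ∀ x : Fin n → ℝ,
      0 ≤ V x - φ₁ x + ∑ i, (s₁ i x * (x i - 1 / 2) - s₂ i x * (x i + 1 / 2)))
    -- certificate condition (b) with the supply rate `w(u,y) = uᵀy - ν uᵀu`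
    (hb : ∀ (x : Fin n → ℝ) (u : Fin m → ℝ) (ε : Fin n → ℝ) (ε' : Fin m → ℝ),
      0 ≤
        (∑ i, (-(pder i V x) *
              (bernShift2 (μx i) (μu i) (fun a b => f a b i) x u + ε i) +
            s₃ i x u * (ε i - ebar i) - s₄ i x u * (ε i + ebar i) +
            s₅ i x u * (x i - 1 / 2) - s₆ i x u * (x i + 1 / 2))) +
          (∑ j, (s₇ j x u * (u j - 1 / 2) - s₈ j x u * (u j + 1 / 2))) +
          (∑ j, (s₉ j x u * (ε' j - ebar' j) - s₁₀ j x u * (ε' j + ebar' j))) +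
          supplyIFP ν u
            (fun j => bernShift2 (ηx j) (ηu j) (fun a b => h a b j) x u + ε' j)) :
    -- conclusion: the system is locally input feedforward passive with index `ν`
    (∀ x : Fin n → ℝ, (∀ j, |x j| ≤ 1 / 2) → 0 ≤ V x) ∧
      ∀ (xtr : ℝ → (Fin n → ℝ)) (utr : ℝ → (Fin m → ℝ)),
        (∀ t, HasDerivAt xtr (f (xtr t) (utr t)) t) →
        (∀ t j, |utr t j| ≤ 1 / 2) →
        (∀ t j, |xtr t j| ≤ 1 / 2) →
        ∀ T' : ℝ, 0 ≤ T' →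
        IntervalIntegrable
          (fun t => ∑ j, utr t j * h (xtr t) (utr t) j) MeasureTheory.volume 0 T' →
        IntervalIntegrable
          (fun t => ∑ j, utr t j * utr t j) MeasureTheory.volume 0 T' →
        V (xtr T') - V (xtr 0) + ν * ∫ t in (0 : ℝ)..T', ∑ j, utr t j * utr t j ≤
          ∫ t in (0 : ℝ)..T', ∑ j, utr t j * h (xtr t) (utr t) j := by
  refine ⟨fun x hx => ?_, fun xtr utr hxtr hu hx T hT hwint huint => ?_⟩
  · have hφ : 0 ≤ φ₁ x := by
      rcases eq_or_ne x 0 with rfl | hx0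
      · exact hφ₁.2.1.ge
      · exact (hφ₁.2.2 x hx0).le
    have hsum : ∑ i, (s₁ i x * (x i - 1 / 2) - s₂ i x * (x i + 1 / 2)) ≤ 0 :=
      Finset.sum_nonpos fun i _ => multiplier_nonpos ((hs₁ i).2 x) ((hs₂ i).2 x) (hx i)
    linarith [ha x]
  · have dissipation : ∀ t, ∑ i, pder i V (xtr t) * f (xtr t) (utr t) i ≤
        (∑ j, utr t j * h (xtr t) (utr t) j) - ν * ∑ j, utr t j * utr t j := by
      intro t
      have hcert := hb (xtr t) (utr t)
        (fun i => f (xtr t) (utr t) i -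
          bernShift2 (μx i) (μu i) (fun a b => f a b i) (xtr t) (utr t))
        (fun j => h (xtr t) (utr t) j -
          bernShift2 (ηx j) (ηu j) (fun a b => h a b j) (xtr t) (utr t))
      simp only [add_sub_cancel, supplyIFP] at hcert
      have hstate : ∑ i, (-(pder i V (xtr t)) * f (xtr t) (utr t) i +
            s₃ i (xtr t) (utr t) * (f (xtr t) (utr t) i -
              bernShift2 (μx i) (μu i) (fun a b => f a b i) (xtr t) (utr t) - ebar i) -
            s₄ i (xtr t) (utr t) * (f (xtr t) (utr t) i -
              bernShift2 (μx i) (μu i) (fun a b => f a b i) (xtr t) (utr t) + ebar i) +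
            s₅ i (xtr t) (utr t) * (xtr t i - 1 / 2) -
            s₆ i (xtr t) (utr t) * (xtr t i + 1 / 2)) ≤
          -∑ i, pder i V (xtr t) * f (xtr t) (utr t) i := by
        rw [← Finset.sum_neg_distrib]
        refine Finset.sum_le_sum fun i _ => ?_
        have hε := multiplier_nonpos ((hs₃ i).2 (xtr t) (utr t)) ((hs₄ i).2 (xtr t) (utr t))
          (hfb i (xtr t) (hx t) (utr t) (hu t))
        have hbox := multiplier_nonpos ((hs₅ i).2 (xtr t) (utr t))
          ((hs₆ i).2 (xtr t) (utr t)) (hx t i)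
        linarith
      have hinput := Finset.sum_nonpos fun j (_ : j ∈ Finset.univ) =>
        multiplier_nonpos ((hs₇ j).2 (xtr t) (utr t)) ((hs₈ j).2 (xtr t) (utr t)) (hu t j)
      have houtput := Finset.sum_nonpos fun j (_ : j ∈ Finset.univ) =>
        multiplier_nonpos ((hs₉ j).2 (xtr t) (utr t)) ((hs₁₀ j).2 (xtr t) (utr t))
          (hhb j (xtr t) (hx t) (utr t) (hu t))
      linarith
    have hderiv : ∀ t, HasDerivAt (fun s => V (xtr s))
        (∑ i, pder i V (xtr t) * f (xtr t) (utr t) i) t :=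
      fun t => hasDerivAt_comp_pder hV.differentiable.differentiableAt (hxtr t)
    have hint := intervalIntegral.sub_le_integral_of_hasDeriv_right_of_le hT
      (fun t _ => (hderiv t).continuousAt.continuousWithinAt)
      (fun t _ => (hderiv t).hasDerivWithinAt)
      ((intervalIntegrable_iff_integrableOn_Icc_of_le hT).mp (hwint.sub (huint.const_mul ν)))
      (fun t _ => dissipation t)
    rw [intervalIntegral.integral_sub hwint (huint.const_mul ν),
      intervalIntegral.integral_const_mul] at hint
    linarith
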